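/- arXiv:2312.11329 — 2 statements merged into one kernel-verified Lean document; each statement's English description precedes it below -/
import Mathlib

section
/- One-step refinement of the lower bound is controlled by the uncertainty at the new data point: if z⁺ ∈ Z and D′ := D ∪ {z⁺}, then for every z ∈ ℝ^d and every component i, 0 ≤ w^min_{D′}(z)_i − w^min_D(z)_i ≤ w^max_D(z⁺)_i − w^min_D(z⁺)_i. -/
open scoped Classical

/-- Kinky-inference upper confidence bound (componentwise):
`w^max_D(z)_i = min_{y ∈ D} (f_i(y) + q‖z − y‖^λ)`. -/
noncomputable def wmax {d n : ℕ} (f : EuclideanSpace ℝ (Fin d) → EuclideanSpace ℝ (Fin n))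
    (q lam : ℝ) (D : Finset (EuclideanSpace ℝ (Fin d))) (hD : D.Nonempty)
    (z : EuclideanSpace ℝ (Fin d)) (i : Fin n) : ℝ :=
  D.inf' hD fun y => f y i + q * ‖z - y‖ ^ lam

/-- Kinky-inference lower confidence bound (componentwise):
`w^min_D(z)_i = max_{y ∈ D} (f_i(y) − q‖z − y‖^λ)`. -/
noncomputable def wmin {d n : ℕ} (f : EuclideanSpace ℝ (Fin d) → EuclideanSpace ℝ (Fin n))
    (q lam : ℝ) (D : Finset (EuclideanSpace ℝ (Fin d))) (hD : D.Nonempty)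
    (z : EuclideanSpace ℝ (Fin d)) (i : Fin n) : ℝ :=
  D.sup' hD fun y => f y i - q * ‖z - y‖ ^ lam

section Bounds

variable {d n : ℕ} {f : EuclideanSpace ℝ (Fin d) → EuclideanSpace ℝ (Fin n)} {q lam : ℝ}
  {Z : Set (EuclideanSpace ℝ (Fin d))} {D : Finset (EuclideanSpace ℝ (Fin d))}

lemma abs_coord_sub_le_of_holder
    (hf : ∀ z₁ ∈ Z, ∀ z₂ ∈ Z, ‖f z₁ - f z₂‖ ≤ q * ‖z₁ - z₂‖ ^ lam)
    {x y : EuclideanSpace ℝ (Fin d)} (hx : x ∈ Z) (hy : y ∈ Z) (i : Fin n) :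
    |f x i - f y i| ≤ q * ‖x - y‖ ^ lam := by
  simpa using (PiLp.norm_apply_le (f x - f y) i).trans (hf x hx y hy)

lemma le_wmax_of_holder
    (hf : ∀ z₁ ∈ Z, ∀ z₂ ∈ Z, ‖f z₁ - f z₂‖ ≤ q * ‖z₁ - z₂‖ ^ lam)
    (hD : D.Nonempty) (hDZ : ↑D ⊆ Z) {x : EuclideanSpace ℝ (Fin d)} (hx : x ∈ Z)
    (i : Fin n) : f x i ≤ wmax f q lam D hD x i := by
  refine Finset.le_inf' _ _ fun y hy => ?_
  linarith [(abs_le.mp (abs_coord_sub_le_of_holder hf hx (hDZ hy) i)).2]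

lemma wmin_le_of_holder
    (hf : ∀ z₁ ∈ Z, ∀ z₂ ∈ Z, ‖f z₁ - f z₂‖ ≤ q * ‖z₁ - z₂‖ ^ lam)
    (hD : D.Nonempty) (hDZ : ↑D ⊆ Z) {x : EuclideanSpace ℝ (Fin d)} (hx : x ∈ Z)
    (i : Fin n) : wmin f q lam D hD x i ≤ f x i := by
  refine Finset.sup'_le _ _ fun y hy => ?_
  linarith [(abs_le.mp (abs_coord_sub_le_of_holder hf hx (hDZ hy) i)).1]

lemma norm_sub_rpow_le_add {E : Type*} [SeminormedAddCommGroup E] {p : ℝ}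
    (hp0 : 0 ≤ p) (hp1 : p ≤ 1) (x y z : E) :
    ‖x - z‖ ^ p ≤ ‖x - y‖ ^ p + ‖y - z‖ ^ p :=
  (Real.rpow_le_rpow (norm_nonneg _) (norm_sub_le_norm_sub_add_norm_sub x y z) hp0).trans
    (Real.rpow_add_le_add_rpow (norm_nonneg _) (norm_nonneg _) hp0 hp1)

lemma wmin_le_wmin_add (hq : 0 ≤ q) (hlam0 : 0 ≤ lam) (hlam1 : lam ≤ 1)
    (hD : D.Nonempty) (x z : EuclideanSpace ℝ (Fin d)) (i : Fin n) :
    wmin f q lam D hD x i ≤ wmin f q lam D hD z i + q * ‖z - x‖ ^ lam := by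
  refine Finset.sup'_le _ _ fun y hy => ?_
  have hle : f y i - q * ‖z - y‖ ^ lam ≤ wmin f q lam D hD z i :=
    Finset.le_sup' (fun y => f y i - q * ‖z - y‖ ^ lam) hy
  have := mul_le_mul_of_nonneg_left (norm_sub_rpow_le_add hlam0 hlam1 z x y) hq
  linarith

lemma wmin_insert (hD : D.Nonempty) (x z : EuclideanSpace ℝ (Fin d)) (i : Fin n) :
    wmin f q lam (insert x D) (Finset.insert_nonempty _ _) z i =
      max (f x i - q * ‖z - x‖ ^ lam) (wmin f q lam D hD z i) :=
  Finset.sup'_insert hD _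

end Bounds

/-- One-step refinement of the lower bound is controlled by the
uncertainty at the new data point: if `z⁺ ∈ Z` and `D′ := D ∪ {z⁺}`, then for every
`z ∈ ℝ^d` and component `i`,
`0 ≤ w^min_{D′}(z)_i − w^min_D(z)_i ≤ w^max_D(z⁺)_i − w^min_D(z⁺)_i`. -/
theorem kinky_lower_refinement (d n : ℕ) (Z : Set (EuclideanSpace ℝ (Fin d)))
    (f : EuclideanSpace ℝ (Fin d) → EuclideanSpace ℝ (Fin n)) (q lam : ℝ)
    (hq : 0 < q) (hlam0 : 0 < lam) (hlam1 : lam ≤ 1)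
    (hf : ∀ z₁ ∈ Z, ∀ z₂ ∈ Z, ‖f z₁ - f z₂‖ ≤ q * ‖z₁ - z₂‖ ^ lam)
    (D : Finset (EuclideanSpace ℝ (Fin d))) (hD : D.Nonempty) (hDZ : ↑D ⊆ Z)
    (zplus : EuclideanSpace ℝ (Fin d)) (hzplus : zplus ∈ Z) :
    ∀ z : EuclideanSpace ℝ (Fin d), ∀ i : Fin n,
      0 ≤ wmin f q lam (insert zplus D) (Finset.insert_nonempty _ _) z i -
            wmin f q lam D hD z i ∧
      wmin f q lam (insert zplus D) (Finset.insert_nonempty _ _) z i -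
            wmin f q lam D hD z i ≤
        wmax f q lam D hD zplus i - wmin f q lam D hD zplus i := by
  intro z i
  have hmax := le_wmax_of_holder hf hD hDZ hzplus i
  have hmin := wmin_le_of_holder hf hD hDZ hzplus i
  have hshift := wmin_le_wmin_add (f := f) hq.le hlam0.le hlam1 hD zplus z i
  rw [wmin_insert hD]
  refine ⟨sub_nonneg.mpr (le_max_right _ _), sub_le_iff_le_add.mpr (max_le ?_ ?_)⟩ <;> linarith
end

section
/- The uncertainty along the visited trajectory vanishes asymptotically: for every sequence (z_t)_{t≥0} with z_t ∈ Z for all t, defining the data sets D₀ := {z*} for an arbitrary fixed z* ∈ Z and D_{t+1} := D_t ∪ {z_t}, one has lim_{t→∞} h_{D_t}(z_t) = 0. -/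
open scoped Classical

/-- The uncertainty level `h_D(z) := ‖w^max_D(z) − w^min_D(z)‖` (Euclidean norm). -/
noncomputable def hunc {d n : ℕ} (f : EuclideanSpace ℝ (Fin d) → EuclideanSpace ℝ (Fin n))
    (q lam : ℝ) (D : Finset (EuclideanSpace ℝ (Fin d))) (hD : D.Nonempty)
    (z : EuclideanSpace ℝ (Fin d)) : ℝ :=
  ‖(EuclideanSpace.equiv (Fin n) ℝ).symm fun i =>
      wmax f q lam D hD z i - wmin f q lam D hD z i‖

/-- The data sets `D₀ := {z*}` and `D_{t+1} := D_t ∪ {z_t}`. -/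
noncomputable def DSeq {d : ℕ} (zstar : EuclideanSpace ℝ (Fin d))
    (zs : ℕ → EuclideanSpace ℝ (Fin d)) : ℕ → Finset (EuclideanSpace ℝ (Fin d))
  | 0 => {zstar}
  | t + 1 => insert (zs t) (DSeq zstar zs t)

/-- Each data set `D_t` is nonempty. -/
theorem DSeq_nonempty {d : ℕ} (zstar : EuclideanSpace ℝ (Fin d))
    (zs : ℕ → EuclideanSpace ℝ (Fin d)) : ∀ t, (DSeq zstar zs t).Nonempty
  | 0 => ⟨zstar, by simp [DSeq]⟩
  | t + 1 => Finset.insert_nonempty _ _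

/-- A class `K∞` function: strictly increasing on `[0, ∞)`, vanishing at `0`, mapping
`[0, ∞)` into `[0, ∞)`, and tending to `∞` at `∞`. -/
def IsKInf (α : ℝ → ℝ) : Prop :=
  StrictMonoOn α (Set.Ici 0) ∧ α 0 = 0 ∧ (∀ t, 0 ≤ t → 0 ≤ α t) ∧
    Filter.Tendsto α Filter.atTop Filter.atTop

/-- In a totally bounded set, every sequence eventually stays arbitrarily close to its past. -/
theorem TotallyBounded.eventually_exists_lt_dist_lt {X : Type*} [PseudoMetricSpace X]
    {Z : Set X} (hZ : TotallyBounded Z) {u : ℕ → X} (hu : ∀ t, u t ∈ Z) {ε : ℝ} (hε : 0 < ε) :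
    ∀ᶠ t in Filter.atTop, ∃ s < t, dist (u t) (u s) < ε := by
  obtain ⟨C, hC, hZC⟩ := Metric.totallyBounded_iff.1 hZ (ε / 2) (half_pos hε)
  have hcover : ∀ t, ∃ c ∈ C, dist (u t) c < ε / 2 := fun t => by
    simpa using hZC (hu t)
  choose c hcC hc using hcover
  have hfin : {t | ¬ ∃ s < t, dist (u t) (u s) < ε}.Finite := by
    refine Set.Finite.of_finite_image (f := c)
      (hC.subset (Set.image_subset_iff.2 fun t _ => hcC t)) ?_
    have key : ∀ s t, c s = c t → dist (u t) (u s) < ε := fun s t h => by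
      have h₁ := hc s
      have h₂ := hc t
      rw [h] at h₁
      linarith [dist_triangle_right (u t) (u s) (c t)]
    intro s hs t ht hst
    rcases lt_trichotomy s t with h | h | h
    · exact absurd ⟨s, h, key s t hst⟩ ht
    · exact h
    · exact absurd ⟨t, h, key t s hst.symm⟩ hs
  have := hfin.eventually_cofinite_notMem
  rw [Nat.cofinite_eq_atTop] at this
  filter_upwards [this] with t ht
  simpa using ht

theorem mem_DSeq_of_lt {d : ℕ} (zstar : EuclideanSpace ℝ (Fin d))
    (zs : ℕ → EuclideanSpace ℝ (Fin d)) {s t : ℕ} (h : s < t) : zs s ∈ DSeq zstar zs t := by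
  induction t with
  | zero => omega
  | succ t ih =>
    rcases Nat.lt_succ_iff_lt_or_eq.1 h with h | rfl
    · exact Finset.mem_insert_of_mem (ih h)
    · exact Finset.mem_insert_self _ _

theorem DSeq_subset {d : ℕ} {Z : Set (EuclideanSpace ℝ (Fin d))}
    {zstar : EuclideanSpace ℝ (Fin d)} (hzstar : zstar ∈ Z)
    {zs : ℕ → EuclideanSpace ℝ (Fin d)} (hzs : ∀ t, zs t ∈ Z) (t : ℕ) :
    ∀ y ∈ DSeq zstar zs t, y ∈ Z := by
  induction t with
  | zero => simpa [DSeq] using hzstar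
  | succ t ih => simpa [DSeq] using ⟨hzs t, ih⟩

theorem wmax_sub_wmin_le {d n : ℕ} (f : EuclideanSpace ℝ (Fin d) → EuclideanSpace ℝ (Fin n))
    (q lam : ℝ) {D : Finset (EuclideanSpace ℝ (Fin d))} (hD : D.Nonempty)
    (z : EuclideanSpace ℝ (Fin d)) (i : Fin n) {y : EuclideanSpace ℝ (Fin d)} (hy : y ∈ D) :
    wmax f q lam D hD z i - wmin f q lam D hD z i ≤ 2 * (q * ‖z - y‖ ^ lam) := by
  have h₁ : wmax f q lam D hD z i ≤ f y i + q * ‖z - y‖ ^ lam :=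
    Finset.inf'_le (fun y => f y i + q * ‖z - y‖ ^ lam) hy
  have h₂ : f y i - q * ‖z - y‖ ^ lam ≤ wmin f q lam D hD z i :=
    Finset.le_sup' (fun y => f y i - q * ‖z - y‖ ^ lam) hy
  linarith

theorem wmin_le_wmax {d n : ℕ} {f : EuclideanSpace ℝ (Fin d) → EuclideanSpace ℝ (Fin n)}
    {q lam : ℝ} {D : Finset (EuclideanSpace ℝ (Fin d))} (hD : D.Nonempty)
    {z : EuclideanSpace ℝ (Fin d)} (hf : ∀ y ∈ D, ‖f z - f y‖ ≤ q * ‖z - y‖ ^ lam) (i : Fin n) :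
    wmin f q lam D hD z i ≤ wmax f q lam D hD z i := by
  have h : ∀ y ∈ D, |f z i - f y i| ≤ q * ‖z - y‖ ^ lam := fun y hy =>
    (PiLp.norm_apply_le (f z - f y) i).trans (hf y hy)
  trans f z i
  · exact Finset.sup'_le _ _ fun y hy => by linarith [neg_le_of_abs_le (h y hy)]
  · exact Finset.le_inf' _ _ fun y hy => by linarith [le_of_abs_le (h y hy)]

/-- The uncertainty along the visited trajectory vanishes asymptotically:
`lim_{t→∞} h_{D_t}(z_t) = 0` for any trajectory `(z_t)` in `Z`, where `D₀ = {z*}` and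
`D_{t+1} = D_t ∪ {z_t}`. -/
theorem uncertainty_along_trajectory_vanishes (d n : ℕ)
    (Z : Set (EuclideanSpace ℝ (Fin d)))
    (hZc : IsCompact Z) (hZconv : Convex ℝ Z) (hZint : (interior Z).Nonempty)
    (f : EuclideanSpace ℝ (Fin d) → EuclideanSpace ℝ (Fin n)) (q lam : ℝ)
    (hq : 0 < q) (hlam0 : 0 < lam) (hlam1 : lam ≤ 1)
    (hf : ∀ z₁ ∈ Z, ∀ z₂ ∈ Z, ‖f z₁ - f z₂‖ ≤ q * ‖z₁ - z₂‖ ^ lam)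
    (zstar : EuclideanSpace ℝ (Fin d)) (hzstar : zstar ∈ Z)
    (zs : ℕ → EuclideanSpace ℝ (Fin d)) (hzs : ∀ t, zs t ∈ Z) :
    Filter.Tendsto
      (fun t => hunc f q lam (DSeq zstar zs t) (DSeq_nonempty zstar zs t) (zs t))
      Filter.atTop (nhds 0) := by
  have hcomp : ∀ i, Filter.Tendsto
      (fun t => wmax f q lam (DSeq zstar zs t) (DSeq_nonempty zstar zs t) (zs t) i -
        wmin f q lam (DSeq zstar zs t) (DSeq_nonempty zstar zs t) (zs t) i)
      Filter.atTop (nhds 0) := by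
    intro i
    rw [Metric.tendsto_nhds]
    intro ε hε
    have hcont : Filter.Tendsto (fun r : ℝ => 2 * (q * r ^ lam)) (nhds 0) (nhds 0) := by
      have : ContinuousAt (fun r : ℝ => 2 * (q * r ^ lam)) 0 :=
        ((Real.continuousAt_rpow_const 0 lam (Or.inr hlam0.le)).const_mul q).const_mul 2
      simpa [ContinuousAt, Real.zero_rpow hlam0.ne'] using this
    obtain ⟨δ, hδ, hball⟩ := Metric.eventually_nhds_iff.1 (hcont.eventually_lt_const hε)
    filter_upwards [hZc.totallyBounded.eventually_exists_lt_dist_lt hzs hδ] with t ht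
    obtain ⟨s, hst, hs⟩ := ht
    have hnonneg := wmin_le_wmax (DSeq_nonempty zstar zs t)
      (fun y hy => hf (zs t) (hzs t) y (DSeq_subset hzstar hzs t y hy)) i
    have hle := wmax_sub_wmin_le f q lam (DSeq_nonempty zstar zs t) (zs t) i
      (mem_DSeq_of_lt zstar zs hst)
    rw [Real.dist_0_eq_abs, abs_of_nonneg (sub_nonneg.2 hnonneg)]
    refine hle.trans_lt (hball ?_)
    rwa [Real.dist_0_eq_abs, abs_of_nonneg (norm_nonneg _), ← dist_eq_norm]
  have hnorm : Continuous fun v : Fin n → ℝ => ‖(EuclideanSpace.equiv (Fin n) ℝ).symm v‖ :=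
    (EuclideanSpace.equiv (Fin n) ℝ).symm.continuous.norm
  have hlim := (hnorm.tendsto 0).comp (tendsto_pi_nhds.2 hcomp)
  rw [map_zero, norm_zero] at hlim
  exact hlim
end
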